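/- Let L₄ be the linear differential operator on ℂ[t] defined by L₄(y) := y⁽⁵⁾ − 20·t·y''' − 30·y'' + 64·t²·y' + 64·t·y, where ' denotes the formal polynomial derivative. Then for every nonzero polynomial y ∈ ℂ[t], the polynomial L₄(y) is nonzero and has degree equal to deg(y) + 1. -/

import Mathlib

open Polynomial

/-- The operator `L₄ = ∂⁵ − 20t∂³ − 30∂² + 64t²∂ + 64t` (the fourth symmetric power of the
Airy operator `∂² − t`) on `ℂ[t]`. -/
noncomputable def L₄ (y : Polynomial ℂ) : Polynomial ℂ :=
  derivative (derivative (derivative (derivative (derivative y))))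
    - 20 * X * derivative (derivative (derivative y))
    - 30 * derivative (derivative y)
    + 64 * X ^ 2 * derivative y
    + 64 * X * y

theorem coeff_L₄_succ (y : Polynomial ℂ) (m : ℕ) :
    (L₄ y).coeff (m + 1) =
      y.coeff (m + 6) * ((m + 6) * (m + 5) * (m + 4) * (m + 3) * (m + 2))
        - 20 * (y.coeff (m + 3) * ((m + 3) * (m + 2) * (m + 1)))
        - 30 * (y.coeff (m + 3) * ((m + 3) * (m + 2)))
        + 64 * ((m + 1) * y.coeff m) := by
  have h : L₄ y = derivative (derivative (derivative (derivative (derivative y))))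
      - C 20 * (X * derivative (derivative (derivative y)))
      - C 30 * derivative (derivative y) + C 64 * (X * derivative (X * y)) := by
    simp only [L₄, derivative_mul, derivative_X, map_ofNat]
    ring
  rw [h]
  simp only [coeff_add, coeff_sub, coeff_C_mul, coeff_X_mul, coeff_derivative]
  push_cast
  ring

/-- `L₄` sends a nonzero polynomial of degree `N` to a nonzero polynomial of degree `N + 1`. -/
theorem stmt_6 (y : Polynomial ℂ) (hy : y ≠ 0) :
    L₄ y ≠ 0 ∧ (L₄ y).natDegree = y.natDegree + 1 := by
  have hlead : (L₄ y).coeff (y.natDegree + 1) ≠ 0 := by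
    rw [coeff_L₄_succ, coeff_eq_zero_of_natDegree_lt (by omega : y.natDegree < y.natDegree + 6),
      coeff_eq_zero_of_natDegree_lt (by omega : y.natDegree < y.natDegree + 3)]
    have hn : (y.natDegree : ℂ) + 1 ≠ 0 := Nat.cast_add_one_ne_zero _
    have hc : y.coeff y.natDegree ≠ 0 := leadingCoeff_ne_zero.mpr hy
    simpa using And.intro hn hc
  have hle : (L₄ y).natDegree ≤ y.natDegree + 1 := by
    refine natDegree_le_iff_coeff_eq_zero.mpr fun k hk => ?_
    obtain ⟨m, rfl⟩ : ∃ m, k = m + 1 := ⟨k - 1, by omega⟩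
    rw [coeff_L₄_succ, coeff_eq_zero_of_natDegree_lt (by omega : y.natDegree < m + 6),
      coeff_eq_zero_of_natDegree_lt (by omega : y.natDegree < m + 3),
      coeff_eq_zero_of_natDegree_lt (by omega : y.natDegree < m)]
    ring
  exact ⟨fun h => hlead (by rw [h, coeff_zero]), hle.antisymm (le_natDegree_of_ne_zero hlead)⟩
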